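/- For every continuous self-dual antinorm f on the positive orthant ℝ^d₊: (i) f(x) ≤ |x| for all x ∈ ℝ^d₊, where |·| is the Euclidean norm; and (ii) there exists a vector a ∈ ℝ^d₊, a ≠ 0, unique up to multiplication by a positive scalar, such that f(a) = |a|. -/

import Mathlib

open scoped BigOperators

noncomputable section

/-- The positive orthant in Euclidean space `ℝ^d`. -/
def pos (d : ℕ) : Set (EuclideanSpace ℝ (Fin d)) := {x | ∀ i, 0 ≤ x i}

/-- Euclidean inner product of two vectors. -/
def dot {d : ℕ} (p x : EuclideanSpace ℝ (Fin d)) : ℝ := ∑ i, p i * x i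

/-- An antinorm on the positive orthant: nonnegative, positively homogeneous,
concave and strictly positive somewhere. -/
def IsAntinorm {d : ℕ} (f : EuclideanSpace ℝ (Fin d) → ℝ) : Prop :=
  (∀ x ∈ pos d, 0 ≤ f x) ∧
  (∀ x ∈ pos d, ∀ l : ℝ, 0 ≤ l → f (l • x) = l * f x) ∧
  ConcaveOn ℝ (pos d) f ∧
  ∃ x ∈ pos d, 0 < f x

/-- The dual antinorm `f*(p) = inf {⟨p,x⟩/f(x) : x ∈ ℝ^d₊, f(x) ≠ 0}`. -/
def dualAntinorm {d : ℕ} (f : EuclideanSpace ℝ (Fin d) → ℝ)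
    (p : EuclideanSpace ℝ (Fin d)) : ℝ :=
  sInf ((fun x => dot p x / f x) '' {x | x ∈ pos d ∧ f x ≠ 0})

theorem dot_eq_inner {d : ℕ} (p x : EuclideanSpace ℝ (Fin d)) : dot p x = inner ℝ p x := by
  simp [dot, PiLp.inner_apply, mul_comm]

theorem dot_nonneg_of_mem_pos {d : ℕ} {p x : EuclideanSpace ℝ (Fin d)} (hp : p ∈ pos d)
    (hx : x ∈ pos d) : 0 ≤ dot p x :=
  Finset.sum_nonneg fun i _ => mul_nonneg (hp i) (hx i)

theorem isClosed_pos (d : ℕ) : IsClosed (pos d) := by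
  simp only [pos, Set.ofPred_forall]
  exact isClosed_iInter fun i => isClosed_le continuous_const (by fun_prop)

theorem smul_mem_pos {d : ℕ} {x : EuclideanSpace ℝ (Fin d)} (hx : x ∈ pos d) {l : ℝ}
    (hl : 0 ≤ l) : l • x ∈ pos d := fun i => by
  simpa using mul_nonneg hl (hx i)

/-- The duality inequality `f*(p) f(x) ≤ ⟨p, x⟩`. -/
theorem dualAntinorm_mul_le_dot {d : ℕ} {f : EuclideanSpace ℝ (Fin d) → ℝ}
    (hf : ∀ x ∈ pos d, 0 ≤ f x) {p x : EuclideanSpace ℝ (Fin d)} (hp : p ∈ pos d)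
    (hx : x ∈ pos d) : dualAntinorm f p * f x ≤ dot p x := by
  rcases (hf x hx).eq_or_lt with h0 | h0
  · simpa [← h0] using dot_nonneg_of_mem_pos hp hx
  · rw [← le_div_iff₀ h0]
    refine csInf_le ⟨0, ?_⟩ ⟨x, ⟨hx, h0.ne'⟩, rfl⟩
    rintro _ ⟨y, ⟨hy, -⟩, rfl⟩
    exact div_nonneg (dot_nonneg_of_mem_pos hp hy) (hf y hy)

/-- The superlevel set `{f ≥ 1}` of a continuous antinorm has a point `a` minimizing the
linear functional `⟨a, ·⟩` over it, namely its point nearest to the origin. -/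
theorem IsAntinorm.exists_norm_sq_le_dot {d : ℕ} {f : EuclideanSpace ℝ (Fin d) → ℝ}
    (hf : IsAntinorm f) (hc : ContinuousOn f (pos d)) :
    ∃ a ∈ pos d, 1 ≤ f a ∧ ∀ x ∈ pos d, 1 ≤ f x → ‖a‖ ^ 2 ≤ dot a x := by
  obtain ⟨-, hhom, hconc, x₀, hx₀, hpos⟩ := hf
  set K : Set (EuclideanSpace ℝ (Fin d)) := {x ∈ pos d | 1 ≤ f x}
  have hne : K.Nonempty :=
    ⟨(f x₀)⁻¹ • x₀, smul_mem_pos hx₀ (inv_nonneg.2 hpos.le), by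
      rw [hhom x₀ hx₀ _ (inv_nonneg.2 hpos.le), inv_mul_cancel₀ hpos.ne']⟩
  have hclosed : IsClosed K := hc.preimage_isClosed_of_isClosed (isClosed_pos d) isClosed_Ici
  have hconv : Convex ℝ K := hconc.convex_ge 1
  obtain ⟨a, ha, hmin⟩ :=
    exists_norm_eq_iInf_of_complete_convex hne hclosed.isComplete hconv 0
  rw [norm_eq_iInf_iff_real_inner_le_zero hconv ha] at hmin
  refine ⟨a, ha.1, ha.2, fun x hx hfx => ?_⟩
  have h := hmin x ⟨hx, hfx⟩
  rw [zero_sub, inner_neg_left, inner_sub_right, real_inner_self_eq_norm_sq] at h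
  rw [dot_eq_inner]
  linarith

/-- Every continuous self-dual antinorm on `ℝ^d₊` satisfies `f(x) ≤ |x|`
(Euclidean norm), and there is a vector `a ≠ 0`, unique up to positive scaling,
with `f(a) = |a|`. -/
theorem self_dual_antinorm_le_euclidean (d : ℕ)
    (f : EuclideanSpace ℝ (Fin d) → ℝ)
    (hf : IsAntinorm f) (hc : ContinuousOn f (pos d))
    (hsd : ∀ p ∈ pos d, dualAntinorm f p = f p) :
    (∀ x ∈ pos d, f x ≤ ‖x‖) ∧
    ∃ a ∈ pos d, a ≠ 0 ∧ f a = ‖a‖ ∧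
      ∀ b ∈ pos d, b ≠ 0 → f b = ‖b‖ → ∃ t : ℝ, 0 < t ∧ b = t • a := by
  have hmul : ∀ p ∈ pos d, ∀ x ∈ pos d, f p * f x ≤ inner ℝ p x := fun p hp x hx => by
    rw [← hsd p hp, ← dot_eq_inner]
    exact dualAntinorm_mul_le_dot hf.1 hp hx
  have hle : ∀ x ∈ pos d, f x ≤ ‖x‖ := fun x hx => by
    refine abs_le_of_sq_le_sq' ?_ (norm_nonneg x) |>.2
    rw [← real_inner_self_eq_norm_sq, sq]
    exact hmul x hx x hx
  obtain ⟨a, ha, hfa, hmin⟩ := hf.exists_norm_sq_le_dot hc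
  obtain ⟨hnonneg, hhom, -, x₀, hx₀, hpos⟩ := hf
  have hnorm : 1 ≤ ‖a‖ := hfa.trans (hle a ha)
  have ha0 : a ≠ 0 := norm_pos_iff.1 (by linarith)
  have hsq : ‖a‖ ^ 2 ≤ f a := by
    rw [← hsd a ha]
    refine le_csInf ⟨_, x₀, ⟨hx₀, hpos.ne'⟩, rfl⟩ ?_
    rintro _ ⟨x, ⟨hx, hx0⟩, rfl⟩
    have hinv : 0 ≤ (f x)⁻¹ := inv_nonneg.2 (hnonneg x hx)
    have h := hmin ((f x)⁻¹ • x) (smul_mem_pos hx hinv)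
      (by rw [hhom x hx _ hinv, inv_mul_cancel₀ hx0])
    rwa [dot_eq_inner, inner_smul_right, ← dot_eq_inner, inv_mul_eq_div] at h
  have hfa' : f a = ‖a‖ := le_antisymm (hle a ha) (by nlinarith)
  refine ⟨hle, a, ha, ha0, hfa', fun b hb hb0 hfb => ?_⟩
  have hcs : inner ℝ a b = ‖a‖ * ‖b‖ :=
    le_antisymm (real_inner_le_norm a b) (by simpa [hfa', hfb] using hmul a ha b hb)
  have hray := inner_eq_norm_mul_iff_real.1 hcs
  have hna : 0 < ‖a‖ := norm_pos_iff.2 ha0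
  refine ⟨‖b‖ / ‖a‖, div_pos (norm_pos_iff.2 hb0) hna, ?_⟩
  rw [div_eq_inv_mul, mul_smul, hray, smul_smul, inv_mul_cancel₀ hna.ne', one_smul]
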